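/- arXiv:math/0507546 — 4 statements merged into one kernel-verified Lean document; each statement's English description precedes it below -/
import Mathlib

section
/- Let A and B be unital associative algebras over a field K, let γ be a K-algebra automorphism of B, let t be a γ-twisted trace on B, and let τ : A^(k+1) → K be any K-multilinear map. Define F by F((a₀,b₀),…,(a_k,b_k)) = τ(a₀,…,a_k)·t(b₀·b₁⋯b_k). Then for all a₀,…,a_{k+1} ∈ A and b₀,…,b_{k+1} ∈ B: Σ_{i=0}^{k} (−1)^i F((a₀,b₀),…,(a_i·a_{i+1}, b_i·b_{i+1}),…,(a_{k+1},b_{k+1})) + (−1)^{k+1} F((a_{k+1}·a₀, γ(b_{k+1})·b₀),(a₁,b₁),…,(a_k,b_k)) = (b τ)(a₀,…,a_{k+1}) · t(b₀·b₁⋯b_{k+1}), where b is the untwisted Hochschild coboundary on A (i.e. b_γ with γ = id). -/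
/-- The `γ`-twisted Hochschild coboundary of a `p`-cochain `f : A^(p+1) → K`. -/
def twistedHochschildCoboundary {K A : Type*} [Ring K] [Mul A] (γ : A → A) (p : ℕ)
    (f : (Fin (p + 1) → A) → K) : (Fin (p + 2) → A) → K :=
  fun a =>
    (∑ i : Fin (p + 1), (-1 : K) ^ (i : ℕ) *
      f (fun j => if (j : ℕ) < (i : ℕ) then a j.castSucc
                  else if (j : ℕ) = (i : ℕ) then a j.castSucc * a j.succ
                  else a j.succ))
    + (-1 : K) ^ (p + 1) *
      f (fun j => if j = 0 then γ (a (Fin.last (p + 1))) * a 0 else a j.castSucc)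

/-- Multiplying two adjacent entries of a tuple does not change its ordered product. -/
theorem List.prod_ofFn_mul_adjacent {M : Type*} [Monoid M] (n : ℕ) (b : Fin (n + 1) → M)
    (i : Fin n) :
    (List.ofFn fun j : Fin n => if (j : ℕ) < (i : ℕ) then b j.castSucc
      else if (j : ℕ) = (i : ℕ) then b j.castSucc * b j.succ else b j.succ).prod
    = (List.ofFn b).prod := by
  induction n with
  | zero => exact i.elim0
  | succ n ih =>
    refine Fin.cases ?_ (fun i => ?_) i
    · simp [List.ofFn_succ, mul_assoc]
    · rw [List.ofFn_succ, List.ofFn_succ (f := b), List.prod_cons, List.prod_cons,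
        ← ih (fun j => b j.succ) i]
      simp

/-- For a `γ`-twisted trace `t` on `B` and a multilinear `k`-cochain `τ` on `A`, the
`(id × γ)`-twisted Hochschild coboundary of
`F((a₀,b₀),…,(a_k,b_k)) = τ(a₀,…,a_k) ⬝ t(b₀ b₁ ⋯ b_k)` evaluated on
`((a₀,b₀),…,(a_{k+1},b_{k+1}))` equals `(b τ)(a₀,…,a_{k+1}) ⬝ t(b₀ ⋯ b_{k+1})`,
where `b` is the untwisted Hochschild coboundary on `A`. -/
theorem twisted_coboundary_external_product
    {K A B : Type*} [Field K] [Ring A] [Algebra K A] [Ring B] [Algebra K B]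
    (γ : B ≃ₐ[K] B) (t : B →ₗ[K] K)
    (ht : ∀ b₁ b₂ : B, t (b₁ * b₂) = t (γ b₂ * b₁))
    (k : ℕ) (τ : MultilinearMap K (fun _ : Fin (k + 1) => A) K)
    (a : Fin (k + 2) → A) (b : Fin (k + 2) → B) :
    twistedHochschildCoboundary (Prod.map (id : A → A) ⇑γ) k
      (fun x : Fin (k + 1) → A × B =>
        τ (fun i => (x i).1) * t ((List.ofFn fun i => (x i).2).prod))
      (fun i => (a i, b i))
    = twistedHochschildCoboundary (id : A → A) k ⇑τ a * t ((List.ofFn b).prod) := by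
  have hprod (i : Fin (k + 1)) := List.prod_ofFn_mul_adjacent (k + 1) b i
  have hlast : t (List.ofFn fun j : Fin (k + 1) =>
      if j = 0 then γ (b (Fin.last (k + 1))) * b 0 else b j.castSucc).prod
      = t (List.ofFn b).prod := by
    rw [List.ofFn_succ' b, List.concat_eq_append, List.prod_append, List.prod_singleton, ht]
    simp [List.ofFn_succ, mul_assoc]
  simp only [twistedHochschildCoboundary, add_mul, Finset.sum_mul, apply_ite Prod.fst,
    apply_ite Prod.snd, Prod.fst_mul, Prod.snd_mul, Prod.map_fst, Prod.map_snd, hprod, hlast,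
    mul_assoc]
end

section
/- Let g be a Lie algebra over a field K of characteristic 0, h ⊆ g a Lie subalgebra, pr : g → h an h-equivariant projection with curvature C, and let P : h^q → K be a symmetric h-invariant q-multilinear form. Then the Chern–Weil cochain χ(P)(v₁,…,v_{2q}) = (1/q!) Σ_{σ ∈ S_{2q}, σ(2i−1)<σ(2i) for all i} sgn(σ) P(C(v_{σ(1)}, v_{σ(2)}), …, C(v_{σ(2q−1)}, v_{σ(2q)})) is an alternating 2q-multilinear form on g that vanishes whenever one of its arguments lies in h and is h-invariant: Σ_{i=1}^{2q} χ(P)(v₁,…,[x, v_i],…,v_{2q}) = 0 for all x ∈ h and v₁,…,v_{2q} ∈ g; that is, χ(P) is a relative Lie algebra cochain in C^{2q}(g, h; K). -/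
/-- The Chern–Weil cochain `χ(P)` associated to an `h`-equivariant projection `pr : g → h`
(with curvature `C(u,v) = ⁅pr u, pr v⁆ - pr ⁅u, v⁆`) and a `q`-multilinear form `P` on `h`:
`χ(P)(v₁,…,v_{2q}) = (1/q!) ∑_{σ, σ(2i-1) < σ(2i)} sgn σ ⬝
  P(C(v_{σ(1)}, v_{σ(2)}), …, C(v_{σ(2q-1)}, v_{σ(2q)}))`. -/
def chernWeilCochain {K g : Type*} [Field K] [CharZero K] [LieRing g] [LieAlgebra K g]
    (h : LieSubalgebra K g) (pr : g →ₗ[K] h) (q : ℕ)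
    (P : MultilinearMap K (fun _ : Fin q => h) K) :
    (Fin (2 * q) → g) → K :=
  fun v =>
    (q.factorial : K)⁻¹ *
      ∑ σ : Equiv.Perm (Fin (2 * q)),
        if ∀ i : Fin q, σ ⟨2 * (i : ℕ), by have := i.isLt; omega⟩ <
            σ ⟨2 * (i : ℕ) + 1, by have := i.isLt; omega⟩ then
          ((Equiv.Perm.sign σ : ℤ) : K) *
            P (fun i =>
              ⁅pr (v (σ ⟨2 * (i : ℕ), by have := i.isLt; omega⟩)),
                pr (v (σ ⟨2 * (i : ℕ) + 1, by have := i.isLt; omega⟩))⁆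
              - pr ⁅v (σ ⟨2 * (i : ℕ), by have := i.isLt; omega⟩),
                  v (σ ⟨2 * (i : ℕ) + 1, by have := i.isLt; omega⟩)⁆)
        else 0

section ChernWeil

variable {K g : Type*} [Field K] [LieRing g] [LieAlgebra K g]

/-- The index of the first member of the `i`-th pair in `Fin (2 * q)`. -/
def pairFst {q : ℕ} (i : Fin q) : Fin (2 * q) := ⟨2 * (i : ℕ), by have := i.isLt; omega⟩

/-- The index of the second member of the `i`-th pair in `Fin (2 * q)`. -/
def pairSnd {q : ℕ} (i : Fin q) : Fin (2 * q) := ⟨2 * (i : ℕ) + 1, by have := i.isLt; omega⟩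

lemma pairFst_inj {q : ℕ} {i j : Fin q} : pairFst i = pairFst j ↔ i = j := by
  simp [pairFst, Fin.ext_iff]

lemma pairSnd_inj {q : ℕ} {i j : Fin q} : pairSnd i = pairSnd j ↔ i = j := by
  simp [pairSnd, Fin.ext_iff]

lemma pairFst_ne_pairSnd {q : ℕ} (i j : Fin q) : pairFst i ≠ pairSnd j := by
  simp only [pairFst, pairSnd, ne_eq, Fin.ext_iff]
  omega

lemma exists_eq_pair {q : ℕ} (k : Fin (2 * q)) : ∃ i : Fin q, k = pairFst i ∨ k = pairSnd i := by
  refine ⟨⟨(k : ℕ) / 2, by have := k.isLt; omega⟩, ?_⟩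
  simp only [pairFst, pairSnd, Fin.ext_iff]
  omega

/-- A sum over `Fin (2 * q)` can be computed pair by pair. -/
lemma sum_eq_sum_pair {M : Type*} [AddCommMonoid M] {q : ℕ} (f : Fin (2 * q) → M) :
    ∑ k, f k = ∑ i : Fin q, (f (pairFst i) + f (pairSnd i)) := by
  have hsum := Fintype.sum_sum_type (fun s : Fin q ⊕ Fin q => f (Sum.elim pairFst pairSnd s))
  simp only [Sum.elim_inl, Sum.elim_inr] at hsum
  rw [Finset.sum_add_distrib, ← hsum]
  refine (Function.Bijective.sum_comp ⟨?_, ?_⟩ f).symm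
  · refine Function.Injective.sumElim (fun i j => pairFst_inj.1) (fun i j => pairSnd_inj.1)
      pairFst_ne_pairSnd
  · intro k
    obtain ⟨i, rfl | rfl⟩ := exists_eq_pair k
    · exact ⟨Sum.inl i, rfl⟩
    · exact ⟨Sum.inr i, rfl⟩

/-- If `G` is invariant under right multiplication by the transpositions of the pairs in `s`, its
sum over all permutations is `2 ^ #s` times the sum over those increasing on the pairs in `s`. -/
lemma sum_perm_eq_two_pow_mul {q : ℕ} (G : Equiv.Perm (Fin (2 * q)) → K)
    (hG : ∀ i σ, G (σ * Equiv.swap (pairFst i) (pairSnd i)) = G σ) (s : Finset (Fin q)) :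
    ∑ σ, G σ = 2 ^ s.card * ∑ σ, if ∀ i ∈ s, σ (pairFst i) < σ (pairSnd i) then G σ else 0 := by
  induction s using Finset.induction_on with
  | empty => simp
  | insert j s hj ih =>
    rw [ih, Finset.card_insert_of_notMem hj, pow_succ, mul_assoc]
    congr 1
    have key : ∑ σ, (if (∀ i ∈ s, σ (pairFst i) < σ (pairSnd i)) ∧
          σ (pairSnd j) < σ (pairFst j) then G σ else 0) =
        ∑ σ, if ∀ i ∈ insert j s, σ (pairFst i) < σ (pairSnd i) then G σ else 0 := by
      rw [← Equiv.sum_comp (Equiv.mulRight (Equiv.swap (pairFst j) (pairSnd j)))]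
      refine Finset.sum_congr rfl fun σ _ => ?_
      simp only [Equiv.coe_mulRight, hG, Equiv.Perm.mul_apply, Equiv.swap_apply_left,
        Equiv.swap_apply_right, Finset.forall_mem_insert]
      refine if_congr ?_ rfl rfl
      rw [and_comm]
      refine and_congr_right fun _ => forall₂_congr fun i hi => ?_
      have hij : i ≠ j := fun h => hj (h ▸ hi)
      rw [Equiv.swap_apply_of_ne_of_ne (mt pairFst_inj.1 hij) (pairFst_ne_pairSnd _ _),
        Equiv.swap_apply_of_ne_of_ne (pairFst_ne_pairSnd _ _).symm (mt pairSnd_inj.1 hij)]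
    rw [two_mul (Finset.sum _ _)]
    nth_rewrite 1 [← key]
    rw [← Finset.sum_add_distrib]
    refine Finset.sum_congr rfl fun σ _ => ?_
    have hne : σ (pairFst j) ≠ σ (pairSnd j) := σ.injective.ne (pairFst_ne_pairSnd j j)
    simp only [Finset.forall_mem_insert]
    rcases lt_or_gt_of_ne hne with hlt | hlt
    · simp [hlt, hlt.not_gt]
    · simp [hlt, hlt.not_gt]

variable (h : LieSubalgebra K g) (pr : g →ₗ[K] h)

/-- The curvature `C(u, v) = ⁅pr u, pr v⁆ - pr ⁅u, v⁆` as a bilinear map. -/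
def projCurvature : g →ₗ[K] g →ₗ[K] h :=
  LinearMap.mk₂ K (fun u v => ⁅pr u, pr v⁆ - pr ⁅u, v⁆)
    (fun u u' v => by simp only [map_add, add_lie]; abel)
    (fun c u v => by simp only [map_smul, smul_lie, smul_sub])
    (fun u v v' => by simp only [map_add, lie_add]; abel)
    (fun c u v => by simp only [map_smul, lie_smul, smul_sub])

lemma projCurvature_apply (u v : g) :
    projCurvature h pr u v = ⁅pr u, pr v⁆ - pr ⁅u, v⁆ := rfl

lemma projCurvature_swap (u v : g) : projCurvature h pr v u = -projCurvature h pr u v := by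
  simp only [projCurvature_apply]
  rw [← lie_skew (pr u), ← lie_skew u, map_neg]
  abel

variable {h pr}

lemma projCurvature_eq_zero_left (hproj : ∀ x : h, pr (x : g) = x)
    (hequiv : ∀ (x : h) (u : g), pr ⁅(x : g), u⁆ = ⁅x, pr u⁆) (x : h) (u : g) :
    projCurvature h pr x u = 0 := by
  rw [projCurvature_apply, hproj, hequiv, sub_self]

lemma lie_projCurvature (hequiv : ∀ (x : h) (u : g), pr ⁅(x : g), u⁆ = ⁅x, pr u⁆)
    (x : h) (u v : g) :
    ⁅x, projCurvature h pr u v⁆ =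
      projCurvature h pr ⁅(x : g), u⁆ v + projCurvature h pr u ⁅(x : g), v⁆ := by
  simp only [projCurvature_apply, lie_sub, hequiv]
  rw [← hequiv x ⁅u, v⁆, leibniz_lie (x : g) u v, map_add, leibniz_lie x (pr u) (pr v)]
  abel

variable (h pr)

/-- The curvatures of the consecutive pairs of arguments. -/
def pairCurvature {q : ℕ} (w : Fin (2 * q) → g) (i : Fin q) : h :=
  projCurvature h pr (w (pairFst i)) (w (pairSnd i))

lemma pairCurvature_update_pairFst {q : ℕ} (w : Fin (2 * q) → g) (j : Fin q) (x : g) :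
    pairCurvature h pr (Function.update w (pairFst j) x) =
      Function.update (pairCurvature h pr w) j (projCurvature h pr x (w (pairSnd j))) := by
  ext1 i
  by_cases hij : i = j
  · subst hij
    simp [pairCurvature, (pairFst_ne_pairSnd i i).symm]
  · simp [pairCurvature, hij, pairFst_inj, (pairFst_ne_pairSnd j i).symm]

lemma pairCurvature_update_pairSnd {q : ℕ} (w : Fin (2 * q) → g) (j : Fin q) (x : g) :
    pairCurvature h pr (Function.update w (pairSnd j) x) =
      Function.update (pairCurvature h pr w) j (projCurvature h pr (w (pairFst j)) x) := by
  ext1 i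
  by_cases hij : i = j
  · subst hij
    simp [pairCurvature, pairFst_ne_pairSnd i i]
  · simp [pairCurvature, hij, pairSnd_inj, pairFst_ne_pairSnd i j]

lemma pairCurvature_comp_swap {q : ℕ} (w : Fin (2 * q) → g) (j : Fin q) :
    pairCurvature h pr (w ∘ Equiv.swap (pairFst j) (pairSnd j)) =
      Function.update (pairCurvature h pr w) j (-pairCurvature h pr w j) := by
  ext1 i
  by_cases hij : i = j
  · subst hij
    simp [pairCurvature, projCurvature_swap h pr (w (pairFst i))]
  · have h1 : Equiv.swap (pairFst j) (pairSnd j) (pairFst i) = pairFst i :=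
      Equiv.swap_apply_of_ne_of_ne (mt pairFst_inj.1 hij) (pairFst_ne_pairSnd _ _)
    have h2 : Equiv.swap (pairFst j) (pairSnd j) (pairSnd i) = pairSnd i :=
      Equiv.swap_apply_of_ne_of_ne (pairFst_ne_pairSnd _ _).symm (mt pairSnd_inj.1 hij)
    simp [pairCurvature, hij, h1, h2]

variable {q : ℕ} (P : MultilinearMap K (fun _ : Fin q => h) K)

/-- The multilinear form `w ↦ P(C(w₁, w₂), …, C(w_{2q-1}, w_{2q}))`. -/
def curvatureForm : MultilinearMap K (fun _ : Fin (2 * q) => g) K :=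
  MultilinearMap.mk' (fun w => P (pairCurvature h pr w))
    (fun w k x y => by
      obtain ⟨i, rfl | rfl⟩ := exists_eq_pair k <;>
        simp only [pairCurvature_update_pairFst, pairCurvature_update_pairSnd, map_add,
          LinearMap.add_apply, MultilinearMap.map_update_add])
    (fun w k c x => by
      obtain ⟨i, rfl | rfl⟩ := exists_eq_pair k <;>
        simp only [pairCurvature_update_pairFst, pairCurvature_update_pairSnd, map_smul,
          LinearMap.smul_apply, MultilinearMap.map_update_smul])

lemma curvatureForm_apply (w : Fin (2 * q) → g) :
    curvatureForm h pr P w = P (pairCurvature h pr w) := rfl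

lemma curvatureForm_comp_swap (w : Fin (2 * q) → g) (j : Fin q) :
    curvatureForm h pr P (w ∘ Equiv.swap (pairFst j) (pairSnd j)) = -curvatureForm h pr P w := by
  rw [curvatureForm_apply, pairCurvature_comp_swap, MultilinearMap.map_update_neg,
    Function.update_eq_self, curvatureForm_apply]

variable {h pr}

lemma curvatureForm_eq_zero_of_mem (hproj : ∀ x : h, pr (x : g) = x)
    (hequiv : ∀ (x : h) (u : g), pr ⁅(x : g), u⁆ = ⁅x, pr u⁆)
    {w : Fin (2 * q) → g} {k : Fin (2 * q)} (hk : w k ∈ h) : curvatureForm h pr P w = 0 := by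
  obtain ⟨i, hi⟩ := exists_eq_pair k
  refine P.map_coord_zero i ?_
  have hleft := projCurvature_eq_zero_left hproj hequiv ⟨w k, hk⟩
  rcases hi with rfl | rfl
  · exact hleft _
  · rw [pairCurvature, projCurvature_swap, hleft, neg_zero]

lemma sum_curvatureForm_update_lie
    (hequiv : ∀ (x : h) (u : g), pr ⁅(x : g), u⁆ = ⁅x, pr u⁆)
    (hinvP : ∀ (x : h) (m : Fin q → h), ∑ i : Fin q, P (Function.update m i ⁅x, m i⁆) = 0)
    (x : h) (w : Fin (2 * q) → g) :
    ∑ k, curvatureForm h pr P (Function.update w k ⁅(x : g), w k⁆) = 0 := by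
  rw [sum_eq_sum_pair, ← hinvP x (pairCurvature h pr w)]
  refine Finset.sum_congr rfl fun i _ => ?_
  rw [curvatureForm_apply, curvatureForm_apply, pairCurvature_update_pairFst,
    pairCurvature_update_pairSnd, ← MultilinearMap.map_update_add, ← lie_projCurvature hequiv]
  rfl

variable (h pr)

lemma chernWeilCochain_eq_sum [CharZero K] (v : Fin (2 * q) → g) :
    chernWeilCochain h pr q P v = (q.factorial : K)⁻¹ * ((2 : K) ^ q)⁻¹ *
      ∑ σ : Equiv.Perm (Fin (2 * q)),
        ((Equiv.Perm.sign σ : ℤ) : K) * curvatureForm h pr P (v ∘ σ) := by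
  rw [sum_perm_eq_two_pow_mul _ _ Finset.univ, Finset.card_univ, Fintype.card_fin, mul_assoc,
    inv_mul_cancel_left₀ (pow_ne_zero _ two_ne_zero)]
  · simp only [Finset.mem_univ, true_imp_iff]
    rfl
  · intro i σ
    rw [Equiv.Perm.coe_mul, ← Function.comp_assoc, curvatureForm_comp_swap, Equiv.Perm.sign_mul,
      Equiv.Perm.sign_swap (pairFst_ne_pairSnd i i)]
    simp

lemma chernWeilCochain_eq_alternatization [CharZero K] (v : Fin (2 * q) → g) :
    chernWeilCochain h pr q P v = (q.factorial : K)⁻¹ * ((2 : K) ^ q)⁻¹ *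
      MultilinearMap.alternatization (curvatureForm h pr P) v := by
  rw [chernWeilCochain_eq_sum, MultilinearMap.alternatization_apply]
  congr 1
  refine Finset.sum_congr rfl fun σ _ => ?_
  rw [Units.smul_def, zsmul_eq_mul]
  rfl

end ChernWeil

/-- For a symmetric `h`-invariant `q`-multilinear form `P` on `h`, the Chern–Weil cochain
`χ(P)` is a multilinear, alternating `2q`-form on `g` vanishing whenever one of its
arguments lies in `h`, and it is `h`-invariant; i.e. `χ(P) ∈ C^{2q}(g, h; K)`. -/
theorem chernWeilCochain_mem_relative_cochains
    {K g : Type*} [Field K] [CharZero K] [LieRing g] [LieAlgebra K g]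
    (h : LieSubalgebra K g) (pr : g →ₗ[K] h)
    (hproj : ∀ x : h, pr (x : g) = x)
    (hequiv : ∀ (x : h) (u : g), pr ⁅(x : g), u⁆ = ⁅x, pr u⁆)
    (q : ℕ) (P : MultilinearMap K (fun _ : Fin q => h) K)
    (hsym : ∀ (σ : Equiv.Perm (Fin q)) (x : Fin q → h), P (x ∘ σ) = P x)
    (hinvP : ∀ (x : h) (m : Fin q → h),
      ∑ i : Fin q, P (Function.update m i ⁅x, m i⁆) = 0) :
    (∀ (v : Fin (2 * q) → g) (i : Fin (2 * q)) (c : K) (u w : g),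
      chernWeilCochain h pr q P (Function.update v i (c • u + w)) =
        c * chernWeilCochain h pr q P (Function.update v i u) +
          chernWeilCochain h pr q P (Function.update v i w)) ∧
    (∀ (v : Fin (2 * q) → g) (i j : Fin (2 * q)), i ≠ j → v i = v j →
      chernWeilCochain h pr q P v = 0) ∧
    (∀ (v : Fin (2 * q) → g) (i : Fin (2 * q)), v i ∈ h →
      chernWeilCochain h pr q P v = 0) ∧
    (∀ (x : h) (v : Fin (2 * q) → g),
      ∑ i : Fin (2 * q),
        chernWeilCochain h pr q P (Function.update v i ⁅(x : g), v i⁆) = 0) := by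
  refine ⟨fun v i c u w => ?_, fun v i j hij hv => ?_, fun v i hi => ?_, fun x v => ?_⟩
  · simp only [chernWeilCochain_eq_alternatization, AlternatingMap.map_update_add,
      AlternatingMap.map_update_smul, smul_eq_mul]
    ring
  · rw [chernWeilCochain_eq_alternatization, AlternatingMap.map_eq_zero_of_eq _ v hv hij, mul_zero]
  · rw [chernWeilCochain_eq_sum, Finset.sum_eq_zero, mul_zero]
    intro σ _
    rw [curvatureForm_eq_zero_of_mem P hproj hequiv (k := σ.symm i) (by simpa using hi), mul_zero]
  · simp only [chernWeilCochain_eq_sum]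
    rw [← Finset.mul_sum, Finset.sum_comm, Finset.sum_eq_zero, mul_zero]
    intro σ _
    rw [← Finset.mul_sum, ← Equiv.sum_comp σ]
    simp only [Function.update_comp_eq_of_injective _ σ.injective]
    exact mul_eq_zero_of_right _ (sum_curvatureForm_update_lie P hequiv hinvP x (v ∘ σ))
end

section
/- Let g be a Lie algebra over a field K of characteristic 0, h ⊆ g a Lie subalgebra, pr : g → h an h-equivariant projection with curvature C, and let P : h^q → K be a symmetric h-invariant q-multilinear form. Then the Chern–Weil cochain χ(P)(v₁,…,v_{2q}) = (1/q!) Σ_{σ ∈ S_{2q}, σ(2i−1)<σ(2i) for all i} sgn(σ) P(C(v_{σ(1)}, v_{σ(2)}), …, C(v_{σ(2q−1)}, v_{σ(2q)})) is a Lie algebra cocycle with trivial coefficients: (∂_Lie χ(P))(v₁,…,v_{2q+1}) = Σ_{1≤i<j≤2q+1} (−1)^{i+j} χ(P)([v_i, v_j], v₁, …, v̂_i, …, v̂_j, …, v_{2q+1}) = 0 for all v₁,…,v_{2q+1} ∈ g. -/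
namespace ChernWeil

open Equiv Function

section Antisymmetrization

variable {K I : Type*} [Field K] [Fintype I] [DecidableEq I]

/-- Reindexing of a signed sum over permutations by right multiplication. -/
lemma sum_sign_mul_right (ρ : Perm I) (f : Perm I → K) :
    ∑ τ : Perm I, ((Perm.sign τ : ℤ) : K) * f τ =
      ((Perm.sign ρ : ℤ) : K) * ∑ τ : Perm I, ((Perm.sign τ : ℤ) : K) * f (τ * ρ) := by
  rw [← Equiv.sum_comp (Equiv.mulRight ρ), Finset.mul_sum]
  refine Finset.sum_congr rfl fun τ _ => ?_
  simp only [Equiv.coe_mulRight, Perm.sign_mul, Units.val_mul, Int.cast_mul]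
  ring

/-- A function of ordered pairs that vanishes on the diagonal and whose sum over all
permutations of a fixed pair of distinct points vanishes has total sum zero. -/
lemma sum_sum_eq_zero_of_sum_perm [CharZero K] {x y : I} (hxy : x ≠ y) (d : I → I → K)
    (hd : ∀ i, d i i = 0) (hsum : ∑ τ : Perm I, d (τ x) (τ y) = 0) :
    ∑ i, ∑ j, d i j = 0 := by
  have key : ∀ i j, ∑ τ : Perm I, d (τ i) (τ j) = 0 := by
    intro i j
    rcases eq_or_ne i j with rfl | hij
    · simp [hd]
    · let ρ : Perm I := swap (swap x i y) j * swap x i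
      have hx : ρ x = i := by
        simp only [ρ, Perm.mul_apply, swap_apply_left]
        refine swap_apply_of_ne_of_ne (fun h => hxy ?_) hij
        apply (swap x i).injective
        rw [swap_apply_left]
        exact h
      have hy : ρ y = j := by simp [ρ, Perm.mul_apply]
      rw [← hsum, ← Equiv.sum_comp (Equiv.mulRight ρ⁻¹) fun τ => d (τ i) (τ j)]
      refine Finset.sum_congr rfl fun τ _ => ?_
      simp [← hx, ← hy]
  have hcard : (Fintype.card (Perm I) : K) * ∑ i, ∑ j, d i j = 0 := by
    calc (Fintype.card (Perm I) : K) * ∑ i, ∑ j, d i j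
        = ∑ τ : Perm I, ∑ i, ∑ j, d (τ i) (τ j) := by
          rw [← nsmul_eq_mul, ← Finset.card_univ, ← Finset.sum_const]
          refine Finset.sum_congr rfl fun τ _ => ?_
          rw [← Equiv.sum_comp τ]
          exact Finset.sum_congr rfl fun i _ => (Equiv.sum_comp τ fun j => d (τ i) j).symm
      _ = ∑ i, ∑ j, ∑ τ : Perm I, d (τ i) (τ j) := by
          rw [Finset.sum_comm]
          exact Finset.sum_congr rfl fun i _ => Finset.sum_comm
      _ = 0 := by simp [key]
  exact (mul_eq_zero.mp hcard).resolve_left (by exact_mod_cast Fintype.card_ne_zero)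

end Antisymmetrization

variable {K g : Type*} [Field K] [LieRing g] [LieAlgebra K g] {h : LieSubalgebra K g}

/-- The curvature of a linear map `pr : g → h`. -/
def curvature (pr : g →ₗ[K] h) (u v : g) : h := ⁅pr u, pr v⁆ - pr ⁅u, v⁆

lemma curvature_swap (pr : g →ₗ[K] h) (u v : g) : curvature pr v u = -curvature pr u v := by
  rw [curvature, curvature, ← lie_skew (pr v), ← lie_skew v, map_neg]
  abel

lemma curvature_neg_left (pr : g →ₗ[K] h) (u v : g) :
    curvature pr (-u) v = -curvature pr u v := by
  simp only [curvature, map_neg, neg_lie]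
  abel

lemma curvature_neg_right (pr : g →ₗ[K] h) (u v : g) :
    curvature pr u (-v) = -curvature pr u v := by
  simp only [curvature, map_neg, lie_neg]
  abel

/-- The Bianchi defect: its cyclic sum vanishes. -/
def bianchiDefect (pr : g →ₗ[K] h) (x y z : g) : h :=
  curvature pr ⁅x, y⁆ z - ⁅pr z, curvature pr x y⁆

/-- The Bianchi identity. -/
lemma bianchiDefect_cyclic (pr : g →ₗ[K] h) (x y z : g) :
    bianchiDefect pr x y z + bianchiDefect pr y z x + bianchiDefect pr z x y = 0 := by
  have j1 : pr ⁅⁅x, y⁆, z⁆ + pr ⁅⁅y, z⁆, x⁆ + pr ⁅⁅z, x⁆, y⁆ = 0 := by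
    have e : ⁅⁅x, y⁆, z⁆ + ⁅⁅y, z⁆, x⁆ + ⁅⁅z, x⁆, y⁆ =
        -(⁅x, ⁅y, z⁆⁆ + ⁅y, ⁅z, x⁆⁆ + ⁅z, ⁅x, y⁆⁆) := by
      rw [← lie_skew z ⁅x, y⁆, ← lie_skew x ⁅y, z⁆, ← lie_skew y ⁅z, x⁆]
      abel
    rw [← map_add, ← map_add, e, lie_jacobi, neg_zero, map_zero]
  have j2 := lie_jacobi (pr x) (pr y) (pr z)
  have e : bianchiDefect pr x y z + bianchiDefect pr y z x + bianchiDefect pr z x y =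
      -(pr ⁅⁅x, y⁆, z⁆ + pr ⁅⁅y, z⁆, x⁆ + pr ⁅⁅z, x⁆, y⁆) -
        (⁅pr x, ⁅pr y, pr z⁆⁆ + ⁅pr y, ⁅pr z, pr x⁆⁆ + ⁅pr z, ⁅pr x, pr y⁆⁆) := by
    simp only [bianchiDefect, curvature, lie_sub]
    rw [← lie_skew (pr ⁅x, y⁆), ← lie_skew (pr ⁅y, z⁆), ← lie_skew (pr ⁅z, x⁆)]
    abel
  rw [e, j1, j2]
  simp

section Vanishing

variable {I : Type*} [Fintype I] [DecidableEq I] {q : ℕ} [CharZero K]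
  (pr : g →ₗ[K] h) (P : MultilinearMap K (fun _ : Fin q => h) K) (v : I → g)
  {a b : Fin q → I} {z : I}

/-- The antisymmetrization of `P(C₁, …, [pr v_z, C_i], …, C_q)` vanishes, by invariance. -/
lemma sum_sign_lie_curvature_eq_zero
    (hsym : ∀ (σ : Perm (Fin q)) (x : Fin q → h), P (x ∘ σ) = P x)
    (hinvP : ∀ (x : h) (m : Fin q → h), ∑ i : Fin q, P (update m i ⁅x, m i⁆) = 0)
    (ha : Injective a) (hb : Injective b) (hab : ∀ l l', a l ≠ b l')
    (hza : ∀ l, a l ≠ z) (hzb : ∀ l, b l ≠ z) (i : Fin q) :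
    ∑ τ : Perm I, ((Perm.sign τ : ℤ) : K) *
      P (update (fun l => curvature pr (v (τ (a l))) (v (τ (b l)))) i
        ⁅pr (v (τ z)), curvature pr (v (τ (a i))) (v (τ (b i)))⁆) = 0 := by
  set T : Fin q → K := fun i => ∑ τ : Perm I, ((Perm.sign τ : ℤ) : K) *
      P (update (fun l => curvature pr (v (τ (a l))) (v (τ (b l)))) i
        ⁅pr (v (τ z)), curvature pr (v (τ (a i))) (v (τ (b i)))⁆) with hT
  have hconst : ∀ j, T j = T i := by
    intro j
    rcases eq_or_ne i j with rfl | hij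
    · rfl
    let ρ : Perm I := swap (a i) (a j) * swap (b i) (b j)
    have hsign : Perm.sign ρ = 1 := by
      rw [Perm.sign_mul, Perm.sign_swap (ha.ne hij), Perm.sign_swap (hb.ne hij)]
      simp
    have hρa : ∀ l, ρ (a l) = a (swap i j l) := by
      intro l
      simp only [ρ, Perm.mul_apply]
      rw [swap_apply_of_ne_of_ne (hab _ _) (hab _ _), ha.map_swap]
    have hρb : ∀ l, ρ (b l) = b (swap i j l) := by
      intro l
      simp only [ρ, Perm.mul_apply]
      rw [← hb.map_swap, swap_apply_of_ne_of_ne (hab _ _).symm (hab _ _).symm]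
    have hρz : ρ z = z := by
      simp only [ρ, Perm.mul_apply]
      rw [swap_apply_of_ne_of_ne (hzb _).symm (hzb _).symm,
        swap_apply_of_ne_of_ne (hza _).symm (hza _).symm]
    simp only [hT]
    rw [sum_sign_mul_right ρ, hsign, Units.val_one, Int.cast_one, one_mul]
    refine Finset.sum_congr rfl fun τ _ => ?_
    congr 1
    rw [← hsym (swap i j)]
    congr 1
    funext l
    simp only [Function.comp_apply, Perm.mul_apply, hρz, hρa, hρb]
    by_cases hl : l = i
    · subst hl; simp
    · have : swap i j l ≠ j := by
        rw [Ne, swap_apply_eq_iff, swap_apply_right]; exact hl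
      simp [update_of_ne this, update_of_ne hl]
  have hsum : ∑ j, T j = 0 := by
    simp only [hT]
    rw [Finset.sum_comm]
    refine Finset.sum_eq_zero fun τ _ => ?_
    rw [← Finset.mul_sum]
    rw [hinvP (pr (v (τ z))) fun l => curvature pr (v (τ (a l))) (v (τ (b l))), mul_zero]
  rw [Finset.sum_congr rfl fun j _ => hconst j, Finset.sum_const, nsmul_eq_mul,
    Finset.card_univ, Fintype.card_fin] at hsum
  exact (mul_eq_zero.mp hsum).resolve_left (by exact_mod_cast i.pos.ne')

/-- The antisymmetrization of `P(C₁, …, C([v_a, v_b], v_z), …, C_q)` vanishes, by the Bianchi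
identity and invariance. -/
lemma sum_sign_curvature_lie_eq_zero
    (hsym : ∀ (σ : Perm (Fin q)) (x : Fin q → h), P (x ∘ σ) = P x)
    (hinvP : ∀ (x : h) (m : Fin q → h), ∑ i : Fin q, P (update m i ⁅x, m i⁆) = 0)
    (ha : Injective a) (hb : Injective b) (hab : ∀ l l', a l ≠ b l')
    (hza : ∀ l, a l ≠ z) (hzb : ∀ l, b l ≠ z) (i : Fin q) :
    ∑ τ : Perm I, ((Perm.sign τ : ℤ) : K) *
      P (update (fun l => curvature pr (v (τ (a l))) (v (τ (b l)))) i
        (curvature pr ⁅v (τ (a i)), v (τ (b i))⁆ (v (τ z)))) = 0 := by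
  let Q : Perm I → h → K := fun τ u =>
    P (update (fun l => curvature pr (v (τ (a l))) (v (τ (b l)))) i u)
  have hQadd : ∀ τ u u', Q τ (u + u') = Q τ u + Q τ u' := fun τ u u' =>
    P.map_update_add _ _ _ _
  have hQzero : ∀ τ, Q τ 0 = 0 := fun τ => P.map_update_zero _ _
  let ρ : Perm I := swap (a i) (b i) * swap (b i) z
  have hsign : Perm.sign ρ = 1 := by
    rw [Perm.sign_mul, Perm.sign_swap (hab _ _), Perm.sign_swap (hzb _)]
    simp
  have hρa : ρ (a i) = b i := by
    simp only [ρ, Perm.mul_apply]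
    rw [swap_apply_of_ne_of_ne (hab _ _) (hza _), swap_apply_left]
  have hρb : ρ (b i) = z := by
    simp only [ρ, Perm.mul_apply, swap_apply_left]
    rw [swap_apply_of_ne_of_ne (hza _).symm (hzb _).symm]
  have hρz : ρ z = a i := by simp [ρ, Perm.mul_apply]
  have hQρ : ∀ τ u, Q (τ * ρ) u = Q τ u := by
    intro τ u
    simp only [Q]
    congr 1
    funext l
    by_cases hl : l = i
    · subst hl; simp
    · have h1 : ρ (a l) = a l := by
        simp only [ρ, Perm.mul_apply]
        rw [swap_apply_of_ne_of_ne (hab _ _) (hza _),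
          swap_apply_of_ne_of_ne (ha.ne hl) (hab _ _)]
      have h2 : ρ (b l) = b l := by
        simp only [ρ, Perm.mul_apply]
        rw [swap_apply_of_ne_of_ne (hb.ne hl) (hzb _),
          swap_apply_of_ne_of_ne (hab _ _).symm (hb.ne hl)]
      simp only [update_of_ne hl, Perm.mul_apply, h1, h2]
  let S : (I → I → I → K) := fun x y w => ∑ τ : Perm I, ((Perm.sign τ : ℤ) : K) *
    Q τ (bianchiDefect pr (v (τ x)) (v (τ y)) (v (τ w)))
  have hSρ : ∀ x y w, S x y w = S (ρ x) (ρ y) (ρ w) := by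
    intro x y w
    simp only [S]
    rw [sum_sign_mul_right ρ, hsign, Units.val_one, Int.cast_one, one_mul]
    simp only [hQρ, Perm.mul_apply]
  have h3 : S (a i) (b i) z + S (b i) z (a i) + S z (a i) (b i) = 0 := by
    simp only [S]
    rw [← Finset.sum_add_distrib, ← Finset.sum_add_distrib]
    refine Finset.sum_eq_zero fun τ _ => ?_
    rw [← mul_add, ← mul_add, ← hQadd, ← hQadd, bianchiDefect_cyclic, hQzero, mul_zero]
  have hS1 : S (a i) (b i) z = S (b i) z (a i) := by rw [hSρ, hρa, hρb, hρz]
  have hS2 : S (b i) z (a i) = S z (a i) (b i) := by rw [hSρ, hρa, hρb, hρz]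
  have hS : S (a i) (b i) z = 0 := by
    rw [← hS2, ← hS1] at h3
    have : (3 : K) * S (a i) (b i) z = 0 := by rw [← h3]; ring
    exact (mul_eq_zero.mp this).resolve_left (by norm_num)
  have hL := sum_sign_lie_curvature_eq_zero pr P v hsym hinvP ha hb hab hza hzb i
  calc _ = S (a i) (b i) z + ∑ τ : Perm I, ((Perm.sign τ : ℤ) : K) *
      Q τ ⁅pr (v (τ z)), curvature pr (v (τ (a i))) (v (τ (b i)))⁆ := by
        simp only [S]
        rw [← Finset.sum_add_distrib]
        refine Finset.sum_congr rfl fun τ _ => ?_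
        rw [← mul_add, ← hQadd, bianchiDefect, sub_add_cancel]
    _ = 0 := by rw [hS, zero_add]; exact hL

end Vanishing

/-- The first index `2i` of the `i`-th pair. -/
def fstIdx {q : ℕ} (i : Fin q) : Fin (2 * q) := ⟨2 * (i : ℕ), by have := i.isLt; omega⟩

/-- The second index `2i+1` of the `i`-th pair. -/
def sndIdx {q : ℕ} (i : Fin q) : Fin (2 * q) := ⟨2 * (i : ℕ) + 1, by have := i.isLt; omega⟩

lemma fstIdx_injective {q : ℕ} : Injective (fstIdx (q := q)) := by
  intro i j hij
  simp only [fstIdx, Fin.mk.injEq] at hij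
  omega

lemma sndIdx_injective {q : ℕ} : Injective (sndIdx (q := q)) := by
  intro i j hij
  simp only [sndIdx, Fin.mk.injEq] at hij
  omega

lemma fstIdx_ne_sndIdx {q : ℕ} (i j : Fin q) : fstIdx i ≠ sndIdx j := by
  simp only [fstIdx, sndIdx, Ne, Fin.mk.injEq]
  omega

lemma eq_fstIdx_or_sndIdx {q : ℕ} (k : Fin (2 * q)) : ∃ i, k = fstIdx i ∨ k = sndIdx i := by
  refine ⟨⟨(k : ℕ) / 2, by omega⟩, ?_⟩
  simp only [fstIdx, sndIdx, Fin.ext_iff]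
  omega

section Cochain

variable {q : ℕ} (pr : g →ₗ[K] h) (P : MultilinearMap K (fun _ : Fin q => h) K)

/-- The non-antisymmetrized Chern–Weil form `P(C(w₁,w₂), …, C(w_{2q-1},w_{2q}))`. -/
def curvatureForm (w : Fin (2 * q) → g) : K :=
  P fun l => curvature pr (w (fstIdx l)) (w (sndIdx l))

/-- The antisymmetrization of `curvatureForm` over all permutations. -/
def antisymForm (w : Fin (2 * q) → g) : K :=
  ∑ σ : Perm (Fin (2 * q)), ((Perm.sign σ : ℤ) : K) * curvatureForm pr P (w ∘ σ)

lemma map_update_neg_self (m : Fin q → h) (i : Fin q) : P (update m i (-m i)) = -P m := by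
  rw [P.map_update_neg, update_eq_self]

lemma curvatureForm_swap (w : Fin (2 * q) → g) (i : Fin q) :
    curvatureForm pr P (w ∘ swap (fstIdx i) (sndIdx i)) = -curvatureForm pr P w := by
  rw [curvatureForm, curvatureForm, ← map_update_neg_self P _ i]
  congr 1
  funext l
  by_cases hl : l = i
  · subst hl
    simp [curvature_swap pr (w (fstIdx l))]
  · rw [update_of_ne hl]
    simp only [Function.comp_apply]
    rw [swap_apply_of_ne_of_ne (fstIdx_injective.ne hl) (fstIdx_ne_sndIdx _ _),
      swap_apply_of_ne_of_ne (fstIdx_ne_sndIdx _ _).symm (sndIdx_injective.ne hl)]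

lemma curvatureForm_update_neg (w : Fin (2 * q) → g) (k : Fin (2 * q)) :
    curvatureForm pr P (update w k (-w k)) = -curvatureForm pr P w := by
  obtain ⟨i, rfl | rfl⟩ := eq_fstIdx_or_sndIdx k
  all_goals
    rw [curvatureForm, curvatureForm, ← map_update_neg_self P _ i]
    congr 1
    funext l
    by_cases hl : l = i
    · subst hl
      simp [fstIdx_ne_sndIdx, (fstIdx_ne_sndIdx _ _).symm, curvature_neg_left,
        curvature_neg_right]
    · simp [hl, fstIdx_ne_sndIdx, (fstIdx_ne_sndIdx _ _).symm, fstIdx_injective.eq_iff,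
        sndIdx_injective.eq_iff]

lemma antisymForm_comp_perm (w : Fin (2 * q) → g) (π : Perm (Fin (2 * q))) :
    antisymForm pr P (w ∘ π) = ((Perm.sign π : ℤ) : K) * antisymForm pr P w := by
  conv_rhs => rw [antisymForm, ← Equiv.sum_comp (Equiv.mulLeft π), Finset.mul_sum]
  rw [antisymForm]
  refine Finset.sum_congr rfl fun σ _ => ?_
  have hs : ((Perm.sign π : ℤ) : K) * ((Perm.sign π : ℤ) : K) = 1 := by
    rcases Int.units_eq_one_or (Perm.sign π) with hπ | hπ <;> simp [hπ]
  simp only [Equiv.coe_mulLeft, Perm.sign_mul, Units.val_mul, Int.cast_mul, Perm.coe_mul,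
    Function.comp_assoc]
  rw [← mul_assoc, ← mul_assoc, hs, one_mul]

lemma antisymForm_update_neg (w : Fin (2 * q) → g) (k : Fin (2 * q)) :
    antisymForm pr P (update w k (-w k)) = -antisymForm pr P w := by
  rw [antisymForm, antisymForm, ← Finset.sum_neg_distrib]
  refine Finset.sum_congr rfl fun σ _ => ?_
  have : update w k (-w k) ∘ σ = update (w ∘ σ) (σ.symm k) (-(w ∘ σ) (σ.symm k)) := by
    simp [Function.update_comp_equiv]
  rw [this, curvatureForm_update_neg, mul_neg]

/-- Restricting the order of the pairs in a set `s` divides the signed sum by `2 ^ #s`. -/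
lemma two_pow_mul_sum_ordered (w : Fin (2 * q) → g) (s : Finset (Fin q)) :
    (2 : K) ^ s.card * ∑ σ : Perm (Fin (2 * q)),
      (if ∀ i ∈ s, σ (fstIdx i) < σ (sndIdx i) then
        ((Perm.sign σ : ℤ) : K) * curvatureForm pr P (w ∘ σ) else 0) =
      antisymForm pr P w := by
  induction s using Finset.induction_on with
  | empty => simp [antisymForm]
  | insert i s hi ih =>
    rw [← ih, Finset.card_insert_of_notMem hi, pow_succ, mul_assoc]
    congr 1
    set f : Perm (Fin (2 * q)) → K := fun σ =>
      ((Perm.sign σ : ℤ) : K) * curvatureForm pr P (w ∘ σ) with hf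
    let ρ : Perm (Fin (2 * q)) := swap (fstIdx i) (sndIdx i)
    have hfρ : ∀ σ, f (σ * ρ) = f σ := by
      intro σ
      simp only [hf, Perm.sign_mul, Perm.coe_mul, ρ, ← Function.comp_assoc, curvatureForm_swap,
        Perm.sign_swap (fstIdx_ne_sndIdx i i)]
      simp
    have hflip : ∑ σ : Perm (Fin (2 * q)),
        (if ∀ l ∈ insert i s, σ (fstIdx l) < σ (sndIdx l) then f σ else 0) =
        ∑ σ : Perm (Fin (2 * q)),
        (if σ (sndIdx i) < σ (fstIdx i) ∧ ∀ l ∈ s, σ (fstIdx l) < σ (sndIdx l)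
          then f σ else 0) := by
      rw [← Equiv.sum_comp (Equiv.mulRight ρ)]
      refine Finset.sum_congr rfl fun σ _ => ?_
      have hs : (∀ l ∈ s, σ (ρ (fstIdx l)) < σ (ρ (sndIdx l))) ↔
          ∀ l ∈ s, σ (fstIdx l) < σ (sndIdx l) := by
        refine forall₂_congr fun l hl => ?_
        have hli : l ≠ i := fun e => hi (e ▸ hl)
        simp only [ρ]
        rw [swap_apply_of_ne_of_ne (fstIdx_injective.ne hli) (fstIdx_ne_sndIdx _ _),
          swap_apply_of_ne_of_ne (fstIdx_ne_sndIdx _ _).symm (sndIdx_injective.ne hli)]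
      simp only [Equiv.coe_mulRight, hfρ, Finset.forall_mem_insert, Perm.mul_apply, hs]
      simp only [ρ, swap_apply_left, swap_apply_right]
    rw [two_mul]
    nth_rewrite 2 [hflip]
    rw [← Finset.sum_add_distrib]
    refine Finset.sum_congr rfl fun σ _ => ?_
    have hne : σ (fstIdx i) ≠ σ (sndIdx i) := σ.injective.ne (fstIdx_ne_sndIdx i i)
    simp only [Finset.forall_mem_insert]
    rcases lt_or_gt_of_ne hne with hlt | hlt
    · simp [hlt, hlt.not_gt]
    · simp [hlt, hlt.not_gt, hf]

lemma chernWeilCochain_eq [CharZero K] (w : Fin (2 * q) → g) :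
    chernWeilCochain h pr q P w =
      (q.factorial : K)⁻¹ * (((2 : K) ^ q)⁻¹ * antisymForm pr P w) := by
  have h2 : (2 : K) ^ q ≠ 0 := pow_ne_zero _ two_ne_zero
  rw [← two_pow_mul_sum_ordered pr P w Finset.univ, Finset.card_univ, Fintype.card_fin,
    inv_mul_cancel_left₀ h2]
  simp only [Finset.mem_univ, true_imp_iff]
  rfl

end Cochain

section Coboundary

variable {q : ℕ}

/-- The tuple `(⁅u₀, u₁⁆, u₂, …, u_n)`. -/
def bracketFirst {n : ℕ} (u : Fin (n + 1) → g) : Fin n → g := fun k =>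
  if (k : ℕ) = 0 then ⁅u 0, u 1⁆ else u k.succ

/-- The permutation `(i, j, 0, …, î, …, ĵ, …, n)`, for `i < j`. -/
def pairPerm {n : ℕ} (i j : Fin (n + 1)) (hij : i < j) : Perm (Fin (n + 1)) :=
  (Fin.cycleRange j).symm *
    (Fin.cycleRange ⟨(i : ℕ) + 1, by have := j.isLt; have : (i : ℕ) < j := hij; omega⟩).symm

lemma sign_pairPerm {n : ℕ} (i j : Fin (n + 1)) (hij : i < j) :
    ((Perm.sign (pairPerm i j hij) : ℤ) : K) = -(-1) ^ ((i : ℕ) + (j : ℕ)) := by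
  simp only [pairPerm, Perm.sign_mul, Perm.sign_symm, Fin.sign_cycleRange]
  push_cast
  ring

lemma cycleRange_symm_val {n : ℕ} (i k : Fin (n + 1)) :
    ((Fin.cycleRange i).symm k : ℕ) =
      if (k : ℕ) = 0 then (i : ℕ) else if (k : ℕ) ≤ i then (k : ℕ) - 1 else k := by
  refine Fin.cases ?_ (fun l => ?_) k
  · simp
  · simp only [Fin.cycleRange_symm_succ, Fin.succAbove, Fin.lt_def, Fin.val_succ]
    split_ifs <;> simp at * <;> omega

lemma pairPerm_val {n : ℕ} (i j : Fin (n + 1)) (hij : i < j) (k : Fin (n + 1)) :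
    (pairPerm i j hij k : ℕ) =
      if (k : ℕ) = 0 then (i : ℕ) else if (k : ℕ) = 1 then (j : ℕ) else
      if (k : ℕ) - 2 < i then (k : ℕ) - 2 else if (k : ℕ) - 1 < j then (k : ℕ) - 1 else k := by
  have : (i : ℕ) < j := hij
  simp only [pairPerm, Perm.mul_apply, cycleRange_symm_val]
  split_ifs <;> first | contradiction | omega

lemma pairPerm_zero {n : ℕ} (i j : Fin (n + 1)) (hij : i < j) : pairPerm i j hij 0 = i :=
  Fin.ext (by simp [pairPerm_val])

lemma pairPerm_one {n : ℕ} (i j : Fin (n + 1)) (hij : i < j) : pairPerm i j hij 1 = j := by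
  have : (i : ℕ) < j := hij
  have h1 : ((1 : Fin (n + 1)) : ℕ) = 1 := by
    rw [Fin.val_one', Nat.mod_eq_of_lt (by omega)]
  exact Fin.ext (by rw [pairPerm_val, h1]; simp)

variable (pr : g →ₗ[K] h) (P : MultilinearMap K (fun _ : Fin q => h) K)

/-- Permuting the arguments other than the first two. -/
lemma antisymForm_bracketFirst_comp (hq : 0 < q) (u : Fin (2 * q + 1) → g)
    (ρ : Perm (Fin (2 * q + 1))) (h0 : ρ 0 = 0) (h1 : ρ 1 = 1) :
    antisymForm pr P (bracketFirst (u ∘ ρ)) =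
      ((Perm.sign ρ : ℤ) : K) * antisymForm pr P (bracketFirst u) := by
  obtain ⟨⟨p, e⟩, rfl⟩ := Perm.decomposeFin.symm.surjective ρ
  rw [Perm.decomposeFin_symm_apply_zero] at h0
  subst h0
  let z : Fin (2 * q) := ⟨0, by omega⟩
  have hz : (1 : Fin (2 * q + 1)) = z.succ :=
    Fin.ext (by rw [Fin.val_one', Nat.mod_eq_of_lt (by omega)]; rfl)
  have hsucc : ∀ k : Fin (2 * q), Perm.decomposeFin.symm (0, e) k.succ = (e k).succ := by
    intro k
    simp [Perm.decomposeFin_symm_apply_succ]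
  have hez : e z = z := by
    rw [hz, hsucc] at h1
    exact Fin.succ_injective _ h1
  have hcomp : bracketFirst (u ∘ Perm.decomposeFin.symm (0, e)) = bracketFirst u ∘ e := by
    funext k
    have hk : (k : ℕ) = 0 ↔ (e k : ℕ) = 0 := by
      have hval : ∀ k : Fin (2 * q), (k : ℕ) = 0 ↔ k = z := fun k => by simp [z, Fin.ext_iff]
      rw [hval, hval, ← e.injective.eq_iff, hez]
    simp only [bracketFirst, Function.comp_apply, hsucc, h1, Perm.decomposeFin_symm_apply_zero,
      hk]
  rw [hcomp, antisymForm_comp_perm, Perm.decomposeFin.symm_sign]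
  simp

lemma antisymForm_bracketFirst_swap (hq : 0 < q) (u : Fin (2 * q + 1) → g) :
    antisymForm pr P (bracketFirst (u ∘ swap 0 1)) = -antisymForm pr P (bracketFirst u) := by
  let z : Fin (2 * q) := ⟨0, by omega⟩
  rw [← antisymForm_update_neg pr P _ z]
  congr 1
  funext k
  by_cases hk : k = z
  · subst hk
    simp [bracketFirst, z]
  · have hk' : (k : ℕ) ≠ 0 := fun e => hk (Fin.ext e)
    have h1 : k.succ ≠ 1 := by
      rw [Ne, Fin.ext_iff, Fin.val_one', Nat.mod_eq_of_lt (by omega), Fin.val_succ]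
      omega
    rw [update_of_ne hk]
    simp only [bracketFirst, hk', if_false, Function.comp_apply]
    rw [swap_apply_of_ne_of_ne (Fin.succ_ne_zero k) h1]

lemma sum_sign_antisymForm_bracketFirst [CharZero K]
    (hsym : ∀ (σ : Perm (Fin q)) (x : Fin q → h), P (x ∘ σ) = P x)
    (hinvP : ∀ (x : h) (m : Fin q → h), ∑ i : Fin q, P (update m i ⁅x, m i⁆) = 0)
    (hq : 0 < q) (v : Fin (2 * q + 1) → g) :
    ∑ τ : Perm (Fin (2 * q + 1)), ((Perm.sign τ : ℤ) : K) *
      antisymForm pr P (bracketFirst (v ∘ τ)) = 0 := by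
  simp only [antisymForm, Finset.mul_sum]
  rw [Finset.sum_comm]
  refine Finset.sum_eq_zero fun σ _ => ?_
  simp only [mul_left_comm _ ((Perm.sign σ : ℤ) : K)]
  rw [← Finset.mul_sum, mul_eq_zero]
  right
  let z : Fin (2 * q) := ⟨0, by omega⟩
  have h1v : ((1 : Fin (2 * q + 1)) : ℕ) = 1 := by
    rw [Fin.val_one', Nat.mod_eq_of_lt (by omega)]
  have h01 : (0 : Fin (2 * q + 1)) ≠ 1 := by rw [Ne, Fin.ext_iff, h1v]; simp
  have hs0 : ∀ k : Fin (2 * q), k.succ ≠ 0 := Fin.succ_ne_zero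
  have hs1 : ∀ k : Fin (2 * q), k ≠ z → k.succ ≠ 1 := by
    intro k hk e
    rw [Fin.ext_iff, h1v, Fin.val_succ] at e
    exact hk (Fin.ext (by simp only [z]; omega))
  have hfirst : ∀ u : Fin (2 * q + 1) → g, bracketFirst u z = ⁅u 0, u 1⁆ := fun u => by
    simp [bracketFirst, z]
  have hrest : ∀ (u : Fin (2 * q + 1) → g) (k : Fin (2 * q)), k ≠ z →
      bracketFirst u k = u k.succ := fun u k hk => by
    have : (k : ℕ) ≠ 0 := fun e => hk (Fin.ext e)
    simp [bracketFirst, this]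
  have hinj : ∀ {k k' : Fin (2 * q)}, k ≠ k' → (σ k).succ ≠ (σ k').succ := fun hk =>
    (Fin.succ_injective _).ne (σ.injective.ne hk)
  obtain ⟨i, hi⟩ := eq_fstIdx_or_sndIdx (σ.symm z)
  let a : Fin q → Fin (2 * q + 1) := update (fun l => (σ (fstIdx l)).succ) i 0
  let b : Fin q → Fin (2 * q + 1) := update (fun l => (σ (sndIdx l)).succ) i 1
  have haz : ∀ l, l ≠ i → σ (fstIdx l) ≠ z := by
    intro l hl e
    rw [← e, symm_apply_apply] at hi
    exact hi.elim (fun e => hl (fstIdx_injective e)) (fstIdx_ne_sndIdx _ _)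
  have hbz : ∀ l, l ≠ i → σ (sndIdx l) ≠ z := by
    intro l hl e
    rw [← e, symm_apply_apply] at hi
    exact hi.elim (fun e => fstIdx_ne_sndIdx _ _ e.symm) (fun e => hl (sndIdx_injective e))
  have hai : a i = 0 := update_self ..
  have hbi : b i = 1 := update_self ..
  have hal : ∀ l, l ≠ i → a l = (σ (fstIdx l)).succ := fun l hl => update_of_ne hl ..
  have hbl : ∀ l, l ≠ i → b l = (σ (sndIdx l)).succ := fun l hl => update_of_ne hl ..
  have ha : Injective a := by
    intro l l' e
    by_contra hne
    by_cases hl : l = i <;> by_cases hl' : l' = i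
    · exact hne (hl.trans hl'.symm)
    · rw [hl, hai, hal _ hl'] at e; exact hs0 _ e.symm
    · rw [hl', hai, hal _ hl] at e; exact hs0 _ e
    · rw [hal _ hl, hal _ hl'] at e; exact hinj (fstIdx_injective.ne hne) e
  have hb : Injective b := by
    intro l l' e
    by_contra hne
    by_cases hl : l = i <;> by_cases hl' : l' = i
    · exact hne (hl.trans hl'.symm)
    · rw [hl, hbi, hbl _ hl'] at e; exact hs1 _ (hbz _ hl') e.symm
    · rw [hl', hbi, hbl _ hl] at e; exact hs1 _ (hbz _ hl) e
    · rw [hbl _ hl, hbl _ hl'] at e; exact hinj (sndIdx_injective.ne hne) e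
  have hab : ∀ l l', a l ≠ b l' := by
    intro l l' e
    by_cases hl : l = i <;> by_cases hl' : l' = i
    · rw [hl, hl', hai, hbi] at e; exact h01 e
    · rw [hl, hai, hbl _ hl'] at e; exact hs0 _ e.symm
    · rw [hl', hbi, hal _ hl] at e; exact hs1 _ (haz _ hl) e
    · rw [hal _ hl, hbl _ hl'] at e; exact hinj (fstIdx_ne_sndIdx _ _) e
  rcases hi with hi | hi
  · have hσi : σ (fstIdx i) = z := by rw [← hi, apply_symm_apply]
    have hσi' : σ (sndIdx i) ≠ z := by
      rw [← hσi]; exact σ.injective.ne (fstIdx_ne_sndIdx _ _).symm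
    have hza : ∀ l, a l ≠ (σ (sndIdx i)).succ := by
      intro l e
      by_cases hl : l = i
      · rw [hl, hai] at e; exact hs0 _ e.symm
      · rw [hal _ hl] at e; exact hinj (fstIdx_ne_sndIdx _ _) e
    have hzb : ∀ l, b l ≠ (σ (sndIdx i)).succ := by
      intro l e
      by_cases hl : l = i
      · rw [hl, hbi] at e; exact hs1 _ hσi' e.symm
      · rw [hbl _ hl] at e; exact hinj (sndIdx_injective.ne hl) e
    rw [← sum_sign_curvature_lie_eq_zero pr P v hsym hinvP ha hb hab hza hzb i]
    refine Finset.sum_congr rfl fun τ _ => ?_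
    rw [curvatureForm]
    congr 2
    funext l
    by_cases hl : l = i
    · subst hl
      simp only [update_self, Function.comp_apply, hσi, hfirst, hrest _ _ hσi', hai, hbi]
    · simp only [update_of_ne hl, Function.comp_apply, hrest _ _ (haz l hl),
        hrest _ _ (hbz l hl), hal l hl, hbl l hl]
  · have hσi : σ (sndIdx i) = z := by rw [← hi, apply_symm_apply]
    have hσi' : σ (fstIdx i) ≠ z := by
      rw [← hσi]; exact σ.injective.ne (fstIdx_ne_sndIdx _ _)
    have hza : ∀ l, a l ≠ (σ (fstIdx i)).succ := by
      intro l e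
      by_cases hl : l = i
      · rw [hl, hai] at e; exact hs0 _ e.symm
      · rw [hal _ hl] at e; exact hinj (fstIdx_injective.ne hl) e
    have hzb : ∀ l, b l ≠ (σ (fstIdx i)).succ := by
      intro l e
      by_cases hl : l = i
      · rw [hl, hbi] at e; exact hs1 _ hσi' e.symm
      · rw [hbl _ hl] at e; exact hinj (fstIdx_ne_sndIdx _ _).symm e
    rw [← neg_eq_zero, ← sum_sign_curvature_lie_eq_zero pr P v hsym hinvP ha hb hab hza hzb i,
      ← Finset.sum_neg_distrib]
    refine Finset.sum_congr rfl fun τ _ => ?_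
    rw [← mul_neg, curvatureForm, ← map_update_neg_self P _ i]
    congr 2
    funext l
    by_cases hl : l = i
    · subst hl
      simp only [update_self, Function.comp_apply, hσi, hfirst, hrest _ _ hσi', hai, hbi]
      rw [← curvature_swap]
    · simp only [update_of_ne hl, Function.comp_apply, hrest _ _ (haz l hl),
        hrest _ _ (hbz l hl), hal l hl, hbl l hl]

/-- The coboundary of the antisymmetrized form vanishes. -/
lemma sum_pairPerm_antisymForm_eq_zero [CharZero K]
    (hsym : ∀ (σ : Perm (Fin q)) (x : Fin q → h), P (x ∘ σ) = P x)
    (hinvP : ∀ (x : h) (m : Fin q → h), ∑ i : Fin q, P (update m i ⁅x, m i⁆) = 0)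
    (hq : 0 < q) (v : Fin (2 * q + 1) → g) :
    ∑ i : Fin (2 * q + 1), ∑ j : Fin (2 * q + 1),
      (if hij : i < j then (-1 : K) ^ ((i : ℕ) + (j : ℕ)) *
        antisymForm pr P (bracketFirst (v ∘ pairPerm i j hij)) else 0) = 0 := by
  set G : Perm (Fin (2 * q + 1)) → K := fun τ =>
    ((Perm.sign τ : ℤ) : K) * antisymForm pr P (bracketFirst (v ∘ τ)) with hG
  have h01 : (0 : Fin (2 * q + 1)) ≠ 1 := by
    rw [Ne, Fin.ext_iff, Fin.val_one', Nat.mod_eq_of_lt (by omega)]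
    simp
  have hGpair : ∀ (τ : Perm (Fin (2 * q + 1))) (hτ : τ 0 < τ 1),
      (-1 : K) ^ ((τ 0 : ℕ) + (τ 1 : ℕ)) *
        antisymForm pr P (bracketFirst (v ∘ pairPerm (τ 0) (τ 1) hτ)) = -G τ := by
    intro τ hτ
    let π := pairPerm (τ 0) (τ 1) hτ
    let ρ := π⁻¹ * τ
    have hρ0 : ρ 0 = 0 := by
      rw [Perm.mul_apply, Perm.inv_eq_iff_eq]
      exact (pairPerm_zero _ _ hτ).symm
    have hρ1 : ρ 1 = 1 := by
      rw [Perm.mul_apply, Perm.inv_eq_iff_eq]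
      exact (pairPerm_one _ _ hτ).symm
    have hτρ : τ = π * ρ := by simp [ρ]
    have hcomp : v ∘ τ = (v ∘ π) ∘ ρ := by
      rw [Function.comp_assoc, ← Perm.coe_mul, ← hτρ]
    have hsign : ((Perm.sign τ : ℤ) : K) =
        -(-1) ^ ((τ 0 : ℕ) + (τ 1 : ℕ)) * ((Perm.sign ρ : ℤ) : K) := by
      rw [← sign_pairPerm _ _ hτ]
      conv_lhs => rw [hτρ]
      simp only [Perm.sign_mul, Units.val_mul, Int.cast_mul, π]
    have hs : ((Perm.sign ρ : ℤ) : K) * ((Perm.sign ρ : ℤ) : K) = 1 := by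
      rcases Int.units_eq_one_or (Perm.sign ρ) with hπ | hπ <;> simp [hπ]
    simp only [hG]
    rw [hcomp, antisymForm_bracketFirst_comp pr P hq _ ρ hρ0 hρ1, hsign]
    linear_combination (-(-1) ^ ((τ 0 : ℕ) + (τ 1 : ℕ)) *
        antisymForm pr P (bracketFirst (v ∘ π))) * hs
  have hGswap : ∀ τ, G (τ * swap 0 1) = G τ := by
    intro τ
    simp only [hG, Perm.coe_mul, ← Function.comp_assoc, antisymForm_bracketFirst_swap pr P hq,
      Perm.sign_mul, Perm.sign_swap h01]
    simp
  refine sum_sum_eq_zero_of_sum_perm h01 _ (fun i => by simp) ?_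
  have hrw : ∀ τ : Perm (Fin (2 * q + 1)),
      (if hij : τ 0 < τ 1 then (-1 : K) ^ ((τ 0 : ℕ) + (τ 1 : ℕ)) *
        antisymForm pr P (bracketFirst (v ∘ pairPerm (τ 0) (τ 1) hij)) else 0) =
      -(if τ 0 < τ 1 then G τ else 0) := by
    intro τ
    by_cases hτ : τ 0 < τ 1
    · rw [dif_pos hτ, if_pos hτ, hGpair]
    · rw [dif_neg hτ, if_neg hτ, neg_zero]
  rw [Finset.sum_congr rfl fun τ _ => hrw τ, Finset.sum_neg_distrib, neg_eq_zero]
  have hflip : ∑ τ : Perm (Fin (2 * q + 1)), (if τ 0 < τ 1 then G τ else 0) =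
      ∑ τ : Perm (Fin (2 * q + 1)), (if τ 1 < τ 0 then G τ else 0) := by
    rw [← Equiv.sum_comp (Equiv.mulRight (swap 0 1))]
    refine Finset.sum_congr rfl fun τ _ => ?_
    simp only [Equiv.coe_mulRight, hGswap, Perm.mul_apply, swap_apply_left, swap_apply_right]
  have hdouble : (2 : K) * ∑ τ : Perm (Fin (2 * q + 1)), (if τ 0 < τ 1 then G τ else 0) = 0 := by
    rw [two_mul]
    nth_rewrite 2 [hflip]
    rw [← Finset.sum_add_distrib]
    refine (Finset.sum_congr rfl fun τ _ => ?_).trans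
      (sum_sign_antisymForm_bracketFirst pr P hsym hinvP hq v)
    rcases lt_or_gt_of_ne (τ.injective.ne h01) with hlt | hlt
    · simp [hlt, hlt.not_gt, hG]
    · simp [hlt, hlt.not_gt, hG]
  exact (mul_eq_zero.mp hdouble).resolve_left two_ne_zero

end Coboundary

end ChernWeil

/-- For a symmetric `h`-invariant `q`-multilinear form `P` on `h`, the Chern–Weil cochain
`χ(P)` is a Lie algebra cocycle with trivial coefficients: its Chevalley–Eilenberg coboundary
`(∂_Lie χ(P))(v₁,…,v_{2q+1}) = ∑_{i<j} (-1)^{i+j} χ(P)(⁅v_i, v_j⁆, v₁,…,v̂_i,…,v̂_j,…,v_{2q+1})`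
vanishes. -/
theorem chernWeilCochain_is_lie_cocycle
    {K g : Type*} [Field K] [CharZero K] [LieRing g] [LieAlgebra K g]
    (h : LieSubalgebra K g) (pr : g →ₗ[K] h)
    (hproj : ∀ x : h, pr (x : g) = x)
    (hequiv : ∀ (x : h) (u : g), pr ⁅(x : g), u⁆ = ⁅x, pr u⁆)
    (q : ℕ) (P : MultilinearMap K (fun _ : Fin q => h) K)
    (hsym : ∀ (σ : Equiv.Perm (Fin q)) (x : Fin q → h), P (x ∘ σ) = P x)
    (hinvP : ∀ (x : h) (m : Fin q → h),
      ∑ i : Fin q, P (Function.update m i ⁅x, m i⁆) = 0) :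
    ∀ v : Fin (2 * q + 1) → g,
      (∑ i : Fin (2 * q + 1), ∑ j : Fin (2 * q + 1),
        if (i : ℕ) < (j : ℕ) then
          (-1 : K) ^ ((i : ℕ) + (j : ℕ)) *
            chernWeilCochain h pr q P (fun k : Fin (2 * q) =>
              if (k : ℕ) = 0 then ⁅v i, v j⁆
              else v (if (k : ℕ) - 1 < (i : ℕ) then
                        ⟨(k : ℕ) - 1, by have := k.isLt; omega⟩
                      else if (k : ℕ) < (j : ℕ) then
                        ⟨(k : ℕ), by have := k.isLt; omega⟩
                      else ⟨(k : ℕ) + 1, by have := k.isLt; omega⟩))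
        else 0) = 0 := by
  intro v
  rcases Nat.eq_zero_or_pos q with rfl | hq
  · refine Finset.sum_eq_zero fun i _ => Finset.sum_eq_zero fun j _ => if_neg ?_
    omega
  have key := ChernWeil.sum_pairPerm_antisymForm_eq_zero pr P hsym hinvP hq v
  have hscaled := congrArg (fun t => (q.factorial : K)⁻¹ * (((2 : K) ^ q)⁻¹ * t)) key
  simp only [mul_zero, Finset.mul_sum] at hscaled
  refine (Finset.sum_congr rfl fun i _ => Finset.sum_congr rfl fun j _ => ?_).trans hscaled
  by_cases hij : (i : ℕ) < (j : ℕ)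
  · rw [if_pos hij, dif_pos (show i < j from hij), ChernWeil.chernWeilCochain_eq,
      mul_left_comm, mul_left_comm ((-1 : K) ^ _)]
    congr 4
    funext k
    have h0 := ChernWeil.pairPerm_zero i j hij
    have h1 := ChernWeil.pairPerm_one i j hij
    by_cases hk : (k : ℕ) = 0
    · simp [ChernWeil.bracketFirst, hk, h0, h1]
    · simp only [ChernWeil.bracketFirst, hk, if_false, Function.comp_apply]
      congr 1
      refine Fin.ext ?_
      rw [ChernWeil.pairPerm_val, Fin.val_succ]
      split_ifs <;> first | contradiction | rfl | (dsimp only; omega)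
  · rw [if_neg hij, dif_neg (show ¬ i < j from hij), mul_zero, mul_zero]
end

section
/- Let (V, ω) be a finite-dimensional symplectic real vector space and let γ : V → V be a symplectic linear map of finite order, i.e. γ^m = id for some m ≥ 1. Then there exists a γ-invariant compatible complex structure on V: a linear map J : V → V with J² = −id, such that ω(Ju, Jv) = ω(u, v) for all u, v ∈ V, the bilinear form (u, v) ↦ ω(u, Jv) is symmetric and positive definite, and J ∘ γ = γ ∘ J. -/
/-- A polynomial in `a` commutes with everything that `a` commutes with. -/
theorem Polynomial.commute_aeval {R A : Type*} [CommSemiring R] [Semiring A] [Algebra R A]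
    {a b : A} (h : Commute a b) (q : Polynomial R) : Commute (Polynomial.aeval a q) b := by
  induction q using Polynomial.induction_on' with
  | add p q hp hq => rw [map_add]; exact hp.add_left hq
  | monomial n r =>
    rw [Polynomial.aeval_monomial]
    exact (Algebra.commute_algebraMap_left r b).mul_left (h.pow_left n)

open scoped InnerProductSpace in
/-- A positive definite symmetric operator has a fourth root of its inverse among its
polynomials. -/
theorem LinearMap.IsSymmetric.exists_aeval_pow_four_mul_eq_one
    {V : Type*} [NormedAddCommGroup V] [InnerProductSpace ℝ V] [FiniteDimensional ℝ V]
    {P : Module.End ℝ V} (hP : P.IsSymmetric) (hpos : ∀ v : V, v ≠ 0 → 0 < ⟪v, P v⟫_ℝ) :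
    ∃ q : Polynomial ℝ, (Polynomial.aeval P q) ^ 4 * P = 1 := by
  have hev (i : Fin (Module.finrank ℝ V)) :=
    hP.hasEigenvector_eigenvectorBasis rfl i
  let ev : Fin (Module.finrank ℝ V) → ℝ := hP.eigenvalues rfl
  have hev_pos (i : Fin (Module.finrank ℝ V)) : 0 < ev i := by
    have h := hpos _ (hev i).2
    rw [(hev i).apply_eq_smul, real_inner_smul_right, real_inner_self_eq_norm_sq,
      OrthonormalBasis.norm_eq_one] at h
    simpa using h
  let r : ℝ → ℝ := fun x => x ^ (-(1 / 4) : ℝ)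
  let q : Polynomial ℝ := Lagrange.interpolate (Finset.univ.image ev) _root_.id r
  have hq (i : Fin (Module.finrank ℝ V)) : q.eval (ev i) = r (ev i) :=
    Lagrange.eval_interpolate_at_node (v := _root_.id) r Function.injective_id.injOn
      (Finset.mem_image_of_mem ev (Finset.mem_univ i))
  refine ⟨q, Module.Basis.ext (hP.eigenvectorBasis rfl).toBasis fun i => ?_⟩
  have hr : (r (ev i)) ^ 4 * ev i = 1 := by
    have h : (r (ev i)) ^ 4 = (ev i)⁻¹ := by
      simp only [r]
      rw [← Real.rpow_natCast, ← Real.rpow_mul (hev_pos i).le, ← Real.rpow_neg_one]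
      norm_num
    rw [h, inv_mul_cancel₀ (hev_pos i).ne']
  have h := Module.End.aeval_apply_of_hasEigenvector (p := q ^ 4 * Polynomial.X) (hev i)
  rw [map_mul, map_pow, Polynomial.aeval_X, Polynomial.eval_mul, Polynomial.eval_pow,
    Polynomial.eval_X] at h
  rw [OrthonormalBasis.coe_toBasis, h, Module.End.one_apply]
  change (q.eval (ev i) ^ 4 * ev i) • _ = _
  rw [hq, hr, one_smul]

/-- A polynomial in a symmetric operator is symmetric. -/
theorem LinearMap.IsSymmetric.aeval
    {V : Type*} [NormedAddCommGroup V] [InnerProductSpace ℝ V]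
    {P : Module.End ℝ V} (hP : P.IsSymmetric) (q : Polynomial ℝ) :
    (Polynomial.aeval P q).IsSymmetric := by
  induction q using Polynomial.induction_on' with
  | add p q hp hq => rw [map_add]; exact hp.add hq
  | monomial n a =>
    rw [Polynomial.aeval_monomial, ← Algebra.smul_def]
    exact (hP.pow n).smul (conj_trivial a)

open scoped InnerProductSpace in
/-- A symplectic form on a Euclidean space has a compatible complex structure commuting with
every surjective isometry that preserves the form. -/
theorem exists_compatible_complex_structure_commute_isometry
    {V : Type*} [NormedAddCommGroup V] [InnerProductSpace ℝ V] [FiniteDimensional ℝ V]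
    (ω : V →ₗ[ℝ] V →ₗ[ℝ] ℝ)
    (halt : ∀ v : V, ω v v = 0)
    (hnd : ∀ v : V, (∀ w : V, ω v w = 0) → v = 0)
    (γ : Module.End ℝ V) (hsurj : Function.Surjective γ)
    (hγ : ∀ u v : V, ω (γ u) (γ v) = ω u v)
    (hiso : ∀ u v : V, ⟪γ u, γ v⟫_ℝ = ⟪u, v⟫_ℝ) :
    ∃ J : Module.End ℝ V,
      J ^ 2 = -1 ∧
      (∀ u v : V, ω (J u) (J v) = ω u v) ∧
      (∀ u v : V, ω u (J v) = ω v (J u)) ∧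
      (∀ v : V, v ≠ 0 → 0 < ω v (J v)) ∧
      J * γ = γ * J := by
  have hneg (u v : V) : ω u v = -ω v u := (LinearMap.IsAlt.neg halt v u).symm
  let A : Module.End ℝ V :=
    { toFun := fun u => (InnerProductSpace.toDual ℝ V).symm (LinearMap.toContinuousLinearMap (ω u))
      map_add' := by intros; simp
      map_smul' := by intros; simp }
  have hA (u v : V) : ⟪A u, v⟫_ℝ = ω u v := by
    simp [A, InnerProductSpace.toDual_symm_apply]
  have hskew (u v : V) : ⟪A u, v⟫_ℝ = -⟪u, A v⟫_ℝ := by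
    rw [hA, hneg, real_inner_comm, hA]
  have hA0 (v : V) (hv : v ≠ 0) : A v ≠ 0 := fun h =>
    hv (hnd v fun w => by rw [← hA, h, inner_zero_left])
  let P : Module.End ℝ V := -(A * A)
  have hPA (u v : V) : ⟪u, P v⟫_ℝ = ⟪A u, A v⟫_ℝ := by
    simp [P, hskew]
  have hP : P.IsSymmetric := fun u v => by
    rw [hPA, real_inner_comm, hPA, real_inner_comm]
  obtain ⟨q, hq⟩ := hP.exists_aeval_pow_four_mul_eq_one fun v hv => by
    rw [hPA]
    exact real_inner_self_pos.2 (hA0 v hv)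
  have hT := hP.aeval q
  have hcomm (B : Module.End ℝ V) (hB : Commute A B) : Commute (Polynomial.aeval P q) B :=
    Polynomial.commute_aeval (hB.mul_left hB).neg_left q
  generalize Polynomial.aeval P q = T at hq hT hcomm
  have hAT : T * A = A * T := hcomm A (Commute.refl A)
  have hAγ : A * γ = γ * A := by
    ext u
    refine ext_inner_right ℝ fun w => ?_
    obtain ⟨v, rfl⟩ := hsurj w
    rw [Module.End.mul_apply, Module.End.mul_apply, hA, hγ, hiso, hA]
  have hTγ : T * γ = γ * T := hcomm γ hAγ
  have hATv (v : V) : T (A v) = A (T v) := LinearMap.congr_fun hAT v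
  have hT0 (v : V) (hv : v ≠ 0) : T v ≠ 0 := fun h => by
    have hc : T ^ 4 * P = P * T ^ 4 :=
      ((hcomm A (Commute.refl A)).mul_right (hcomm A (Commute.refl A))).neg_right.pow_left 4
    have h1 := LinearMap.congr_fun (hc.symm.trans hq) v
    exact hv (by simpa [pow_succ, h] using h1.symm)
  let J : Module.End ℝ V := A * T * T
  have hJ2 : J * J = -1 := by
    rw [← hq]
    calc A * T * T * (A * T * T) = A * (T * (T * A)) * T * T := by simp only [mul_assoc]
      _ = (A * A) * T ^ 4 := by
        rw [hAT, ← mul_assoc T A, hAT]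
        simp only [mul_assoc, pow_succ, pow_zero, one_mul]
      _ = T ^ 4 * (A * A) :=
        (((hcomm A (Commute.refl A)).mul_right (hcomm A (Commute.refl A))).pow_left 4).symm
      _ = -(T ^ 4 * P) := by simp [P]
  have hJs (u v : V) : ⟪J u, v⟫_ℝ = -⟪u, J v⟫_ℝ := by
    simp only [J, Module.End.mul_apply]
    rw [hskew, hT, hT, hATv, hATv]
  have hJA (v : V) : A (J v) = J (A v) := by
    simp only [J, Module.End.mul_apply, hATv]
  refine ⟨J, by rw [sq, hJ2], fun u v => ?_, fun u v => ?_, fun v hv => ?_, ?_⟩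
  · rw [← hA, hJA, hJs, ← Module.End.mul_apply, hJ2, ← hA]
    simp
  · rw [hneg v, ← hA, ← hA, hJA, hJs, neg_neg]
  · rw [← hA]
    simp only [J, Module.End.mul_apply]
    rw [← hATv, ← hATv, ← hT]
    exact real_inner_self_pos.2 (hT0 _ (hA0 v hv))
  · simp only [J, mul_assoc]
    rw [hTγ, ← mul_assoc T γ, hTγ, mul_assoc γ, ← mul_assoc A γ, hAγ, mul_assoc]

open scoped InnerProductSpace in
/-- An endomorphism of finite order preserves some inner product. -/
theorem exists_innerProductSpace_core_invariant
    {V : Type*} [AddCommGroup V] [Module ℝ V] [FiniteDimensional ℝ V]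
    (γ : Module.End ℝ V) (m : ℕ) (hm : 1 ≤ m) (hord : γ ^ m = 1) :
    ∃ c : InnerProductSpace.Core ℝ V, ∀ u v : V, c.inner (γ u) (γ v) = c.inner u v := by
  let e : V ≃ₗ[ℝ] EuclideanSpace ℝ (Fin (Module.finrank ℝ V)) :=
    LinearEquiv.ofFinrankEq _ _ (by simp)
  refine ⟨{ inner := fun u v => ∑ k ∈ Finset.range m, ⟪e ((γ ^ k) u), e ((γ ^ k) v)⟫_ℝ
            conj_inner_symm := fun u v => ?_
            re_inner_nonneg := fun v => ?_
            add_left := fun u v w => ?_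
            smul_left := fun u v r => ?_
            definite := fun v h => ?_ }, fun u v => ?_⟩
  · simp [real_inner_comm]
  · rw [RCLike.re_to_real]
    exact Finset.sum_nonneg fun k _ => real_inner_self_nonneg (x := e ((γ ^ k) v))
  · simp [inner_add_left, Finset.sum_add_distrib]
  · simp [real_inner_smul_left, Finset.mul_sum]
  · have h0 := (Finset.sum_eq_zero_iff_of_nonneg fun k _ =>
      real_inner_self_nonneg (x := e ((γ ^ k) v))).1 h 0
      (Finset.mem_range.2 hm)
    simpa using h0
  · change ∑ k ∈ Finset.range m, ⟪e ((γ ^ k) (γ u)), e ((γ ^ k) (γ v))⟫_ℝ =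
      ∑ k ∈ Finset.range m, ⟪e ((γ ^ k) u), e ((γ ^ k) v)⟫_ℝ
    have h1 := Finset.sum_range_succ (fun k => ⟪e ((γ ^ k) u), e ((γ ^ k) v)⟫_ℝ) m
    have h2 := Finset.sum_range_succ' (fun k => ⟪e ((γ ^ k) u), e ((γ ^ k) v)⟫_ℝ) m
    simp only [hord, pow_succ, pow_zero, Module.End.mul_apply] at h1 h2
    linarith


/-- Let `(V, ω)` be a finite-dimensional symplectic real vector space and let `γ` be a
symplectic linear map of finite order. Then there exists a `γ`-invariant compatible complex
structure `J` on `V`: `J² = -1`, `ω(Ju, Jv) = ω(u, v)`, the form `(u, v) ↦ ω(u, Jv)` is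
symmetric positive definite, and `J` commutes with `γ`. -/
theorem exists_invariant_compatible_complex_structure
    {V : Type*} [AddCommGroup V] [Module ℝ V] [FiniteDimensional ℝ V]
    (ω : V →ₗ[ℝ] V →ₗ[ℝ] ℝ)
    (halt : ∀ v : V, ω v v = 0)
    (hnd : ∀ v : V, (∀ w : V, ω v w = 0) → v = 0)
    (γ : Module.End ℝ V)
    (hγ : ∀ u v : V, ω (γ u) (γ v) = ω u v)
    (m : ℕ) (hm : 1 ≤ m) (hord : γ ^ m = 1) :
    ∃ J : Module.End ℝ V,
      J ^ 2 = -1 ∧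
      (∀ u v : V, ω (J u) (J v) = ω u v) ∧
      (∀ u v : V, ω u (J v) = ω v (J u)) ∧
      (∀ v : V, v ≠ 0 → 0 < ω v (J v)) ∧
      J * γ = γ * J := by
  obtain ⟨c, hc⟩ := exists_innerProductSpace_core_invariant γ m hm hord
  let _ : NormedAddCommGroup V := c.toNormedAddCommGroup
  let _ : InnerProductSpace ℝ V := InnerProductSpace.ofCore c.toCore
  have hsurj : Function.Surjective γ := fun v => ⟨(γ ^ (m - 1)) v, by
    rw [← Module.End.mul_apply, ← pow_succ', Nat.sub_add_cancel hm, hord, Module.End.one_apply]⟩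
  exact exists_compatible_complex_structure_commute_isometry ω halt hnd γ hsurj hγ hc
end
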